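/- As t → 0⁺, the ratio φ(Φ^{-1}(t)) / (t · ln(−ln t)) tends to +∞. -/

import Mathlib

open Real MeasureTheory Filter

/-- The standard normal density. -/
noncomputable def stdNormalPDF (x : ℝ) : ℝ := (Real.sqrt (2 * Real.pi))⁻¹ * Real.exp (-x ^ 2 / 2)

/-- The standard normal distribution function. -/
noncomputable def stdNormalCDF (x : ℝ) : ℝ := ∫ t in Set.Iic x, stdNormalPDF t

lemma stdNormalPDF_pos (x : ℝ) : 0 < stdNormalPDF x := by
  unfold stdNormalPDF
  positivity

lemma one_le_sqrt_two_pi : 1 ≤ √(2 * π) :=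
  Real.one_le_sqrt.2 (by linarith [Real.pi_gt_three])

lemma sqrt_two_pi_le_three : √(2 * π) ≤ 3 :=
  Real.sqrt_le_iff.2 ⟨by norm_num, by linarith [Real.pi_le_four]⟩

lemma integrable_stdNormalPDF : Integrable stdNormalPDF := by
  refine ((integrable_exp_neg_mul_sq (b := 1 / 2) (by norm_num)).const_mul
    (√(2 * π))⁻¹).congr (.of_forall fun x => ?_)
  simp only [stdNormalPDF]
  ring_nf

lemma integrable_neg_mul_stdNormalPDF : Integrable fun x => -x * stdNormalPDF x := by
  refine ((integrable_mul_exp_neg_mul_sq (b := 1 / 2) (by norm_num)).const_mul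
    (-(√(2 * π))⁻¹)).congr (.of_forall fun x => ?_)
  simp only [stdNormalPDF]
  ring_nf

lemma hasDerivAt_stdNormalPDF (x : ℝ) : HasDerivAt stdNormalPDF (-x * stdNormalPDF x) x := by
  have h : HasDerivAt (fun x : ℝ => -x ^ 2 / 2) (-x) x :=
    ((hasDerivAt_pow 2 x).neg.div_const 2).congr_deriv (by simp; ring)
  refine (h.exp.const_mul (√(2 * π))⁻¹).congr_deriv ?_
  simp only [stdNormalPDF]
  ring

lemma tendsto_stdNormalPDF_atBot : Tendsto stdNormalPDF atBot (nhds 0) := by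
  have h : Tendsto (fun x : ℝ => -x ^ 2 / 2) atBot atBot := by
    have := (tendsto_pow_atTop (α := ℝ) two_ne_zero).comp tendsto_neg_atBot_atTop
    refine (tendsto_neg_atTop_atBot.comp (this.atTop_div_const two_pos)).congr fun x => ?_
    simp only [Function.comp]
    ring
  rw [← mul_zero (√(2 * π))⁻¹]
  exact (Real.tendsto_exp_atBot.comp h).const_mul _

lemma integral_Iic_neg_mul_stdNormalPDF (x : ℝ) :
    ∫ u in Set.Iic x, -u * stdNormalPDF u = stdNormalPDF x := by
  simpa using integral_Iic_of_hasDerivAt_of_tendsto' (fun u _ => hasDerivAt_stdNormalPDF u)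
    integrable_neg_mul_stdNormalPDF.integrableOn tendsto_stdNormalPDF_atBot

/-- The Mills ratio bound for the lower tail. -/
lemma neg_mul_stdNormalCDF_le (x : ℝ) : -x * stdNormalCDF x ≤ stdNormalPDF x := by
  rw [← integral_Iic_neg_mul_stdNormalPDF x, stdNormalCDF, ← integral_const_mul]
  refine setIntegral_mono_on (integrable_stdNormalPDF.const_mul _).integrableOn
    integrable_neg_mul_stdNormalPDF.integrableOn measurableSet_Iic fun u hu => ?_
  exact mul_le_mul_of_nonneg_right (neg_le_neg hu) (stdNormalPDF_pos u).le

lemma monotone_stdNormalCDF : Monotone stdNormalCDF := fun _ _ h =>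
  setIntegral_mono_set integrable_stdNormalPDF.integrableOn
    (.of_forall fun u => (stdNormalPDF_pos u).le) (Set.Iic_subset_Iic.2 h).eventuallyLE

lemma stdNormalPDF_sub_one_le_stdNormalCDF {x : ℝ} (hx : x ≤ 0) :
    stdNormalPDF (x - 1) ≤ stdNormalCDF x := by
  calc stdNormalPDF (x - 1) = ∫ _ in Set.Ioc (x - 1) x, stdNormalPDF (x - 1) := by simp
    _ ≤ ∫ u in Set.Ioc (x - 1) x, stdNormalPDF u := by
      refine setIntegral_mono_on (by simp)
        integrable_stdNormalPDF.integrableOn measurableSet_Ioc fun u hu => ?_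
      unfold stdNormalPDF
      gcongr ?_ * rexp ?_
      nlinarith [hu.1, hu.2]
    _ ≤ stdNormalCDF x :=
      setIntegral_mono_set integrable_stdNormalPDF.integrableOn
        (.of_forall fun u => (stdNormalPDF_pos u).le) Set.Ioc_subset_Iic_self.eventuallyLE

lemma stdNormalCDF_pos (x : ℝ) : 0 < stdNormalCDF x :=
  calc 0 < stdNormalPDF (min x 0 - 1) := stdNormalPDF_pos _
    _ ≤ stdNormalCDF (min x 0) := stdNormalPDF_sub_one_le_stdNormalCDF (min_le_right _ _)
    _ ≤ stdNormalCDF x := monotone_stdNormalCDF (min_le_left _ _)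

lemma one_lt_neg_log_stdNormalCDF {x : ℝ} (hx : x ≤ -2) : 1 < -log (stdNormalCDF x) := by
  have h : stdNormalCDF x ≤ exp (-2) := by
    have h1 := neg_mul_stdNormalCDF_le x
    have h2 := stdNormalCDF_pos x
    have h3 : stdNormalPDF x ≤ exp (-2) := by
      unfold stdNormalPDF
      calc (√(2 * π))⁻¹ * exp (-x ^ 2 / 2) ≤ 1 * exp (-2) := by
            gcongr
            · exact inv_le_one_of_one_le₀ one_le_sqrt_two_pi
            · nlinarith
        _ = exp (-2) := one_mul _
    nlinarith
  have := Real.log_le_log (stdNormalCDF_pos x) h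
  rw [Real.log_exp] at this
  linarith

lemma neg_log_stdNormalCDF_le {x : ℝ} (hx : x ≤ -2) :
    -log (stdNormalCDF x) ≤ (1 - x) ^ 2 := by
  have h := Real.log_le_log (stdNormalPDF_pos _)
    (stdNormalPDF_sub_one_le_stdNormalCDF (by linarith : x ≤ 0))
  rw [stdNormalPDF, Real.log_mul (by positivity) (by positivity), Real.log_exp,
    Real.log_inv] at h
  have := Real.log_le_sub_one_of_pos (by positivity : 0 < √(2 * π))
  nlinarith [sqrt_two_pi_le_three]

lemma sqrt_div_eight_le {x : ℝ} (hx : x ≤ -2) :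
    √(1 - x) / 8 ≤
      stdNormalPDF x / (stdNormalCDF x * log (-log (stdNormalCDF x))) := by
  have hl := one_lt_neg_log_stdNormalCDF hx
  have hL : 0 < log (-log (stdNormalCDF x)) := Real.log_pos hl
  have hF := stdNormalCDF_pos x
  have hs : 0 < √(1 - x) := Real.sqrt_pos.2 (by linarith)
  have hsq : √(1 - x) ^ 2 = 1 - x := Real.sq_sqrt (by linarith)
  have hU : log (-log (stdNormalCDF x)) ≤ 4 * √(1 - x) := by
    have h := Real.log_le_log (by linarith) (neg_log_stdNormalCDF_le hx)
    rw [← hsq, ← pow_mul, Real.log_pow] at h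
    have := Real.log_le_sub_one_of_pos hs
    push_cast at h
    linarith
  rw [le_div_iff₀ (mul_pos hF hL)]
  calc √(1 - x) / 8 * (stdNormalCDF x * log (-log (stdNormalCDF x)))
      ≤ √(1 - x) / 8 * (stdNormalCDF x * (4 * √(1 - x))) := by gcongr
    _ = (1 - x) / 2 * stdNormalCDF x := by linear_combination stdNormalCDF x / 2 * hsq
    _ ≤ -x * stdNormalCDF x := by gcongr; linarith
    _ ≤ stdNormalPDF x := neg_mul_stdNormalCDF_le x

theorem stmt_15 (Φinv : ℝ → ℝ) (hΦinv : ∀ t ∈ Set.Ioo (0 : ℝ) 1, stdNormalCDF (Φinv t) = t) :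
    Tendsto (fun t : ℝ => stdNormalPDF (Φinv t) / (t * Real.log (-Real.log t)))
      (nhdsWithin 0 (Set.Ioi 0)) atTop := by
  have hbot : Tendsto Φinv (nhdsWithin 0 (Set.Ioi 0)) atBot := by
    refine tendsto_atBot.2 fun b => ?_
    filter_upwards [Ioo_mem_nhdsGT one_pos, Ioo_mem_nhdsGT (stdNormalCDF_pos b)] with t ht htb
    by_contra! hb
    have := monotone_stdNormalCDF hb.le
    rw [hΦinv t ht] at this
    exact this.not_gt htb.2
  have hsqrt : Tendsto (fun x : ℝ => √(1 - x) / 8) atBot atTop :=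
    (Real.tendsto_sqrt_atTop.comp
      (tendsto_const_nhds.add_atTop tendsto_neg_atBot_atTop)).atTop_div_const (by norm_num)
  refine tendsto_atTop_mono' _ ?_ (hsqrt.comp hbot)
  filter_upwards [Ioo_mem_nhdsGT one_pos, hbot.eventually_le_atBot (-2)] with t ht hx
  simpa only [hΦinv t ht, Function.comp_apply] using sqrt_div_eight_le hx
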